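/- Let φ : ℂ → ℝ be a C² function with c ≤ Δφ ≤ C on ℂ for some constants 0 < c ≤ C, and let f be an entire function with f(0) ≠ 0 and sup_{z∈ℂ} |f(z)| e^{-φ(z)} < ∞. Then liminf_{R→∞} n(0,R) / ∫_{D(0,R)} Δφ dA ≤ 1/(2π), where n(0,R) denotes the number of zeros of f, counted with multiplicity, in the closed disk {|z| ≤ R}. In particular, no entire function bounded by a constant times e^{φ} and nonvanishing at the origin can have zero set of lower density greater than the critical value. -/

import Mathlib

open MeasureTheory Metric Set Filter
open scoped ENNReal Topology

noncomputable section

/-- The Laplacian `Δφ = φ_{xx} + φ_{yy}` of a function `φ : ℂ → ℝ`. -/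
def lap (φ : ℂ → ℝ) (z : ℂ) : ℝ :=
  fderiv ℝ (fderiv ℝ φ) z 1 1 + fderiv ℝ (fderiv ℝ φ) z Complex.I Complex.I

/-- The vanishing order of `f` at `z`: the least `k` with `f^{(k)}(z) ≠ 0`
(`0` if `f(z) ≠ 0`, junk value `0` if `f` vanishes to infinite order). -/
def ordAt (f : ℂ → ℂ) (z : ℂ) : ℕ := sInf {k : ℕ | iteratedDeriv k f z ≠ 0}

/-- `n(0,R)`: the number of zeros of `f`, counted with multiplicity, in the closed disk
of radius `R` about the origin. -/
def nZeros (f : ℂ → ℂ) (R : ℝ) : ℕ := ∑ᶠ z ∈ Metric.closedBall (0 : ℂ) R, ordAt f z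

lemma integral_ball_eq_integral_circleMap {g : ℂ → ℝ} (hg : Continuous g) {R : ℝ} (hR : 0 ≤ R) :
    ∫ z in ball (0 : ℂ) R, g z =
      ∫ r in 0..R, ∫ θ in 0..2 * Real.pi, r * g (circleMap 0 r θ) := by
  have hsymm (p : ℝ × ℝ) : Complex.polarCoord.symm p = circleMap 0 p.1 p.2 := by
    simp [circleMap, Complex.exp_mul_I]
  have hcont : Continuous fun p : ℝ × ℝ => p.1 * g (circleMap 0 p.1 p.2) := by fun_prop
  have hset : polarCoord.target ∩ {p : ℝ × ℝ | p.1 < R} =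
      Ioo 0 R ×ˢ Ioo (-Real.pi) Real.pi := by
    ext ⟨r, θ⟩
    simp only [polarCoord_target, mem_inter_iff, mem_prod, mem_Ioi, mem_Ioo, mem_ofPred_eq]
    tauto
  have hmeas : MeasurableSet {p : ℝ × ℝ | p.1 < R} :=
    measurableSet_lt measurable_fst measurable_const
  have hpolar : ∫ z in ball (0 : ℂ) R, g z =
      ∫ p in Ioo 0 R ×ˢ Ioo (-Real.pi) Real.pi, p.1 * g (circleMap 0 p.1 p.2) := by
    rw [← integral_indicator measurableSet_ball, ← Complex.integral_comp_polarCoord_symm, ← hset,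
      ← setIntegral_indicator hmeas]
    refine setIntegral_congr_fun polarCoord.open_target.measurableSet fun p hp => ?_
    have hp1 : 0 < p.1 := hp.1
    by_cases h : p.1 < R
    · simp [hsymm, indicator, h, abs_of_pos hp1]
    · simp [hsymm, indicator, h, abs_of_pos hp1]
  rw [hpolar, Measure.volume_eq_prod, setIntegral_prod _ ?_, intervalIntegral.integral_of_le hR,
    integral_Ioc_eq_integral_Ioo]
  · refine setIntegral_congr_fun measurableSet_Ioo fun r _ => ?_
    have hper : Function.Periodic (fun θ => r * g (circleMap 0 r θ)) (2 * Real.pi) := fun θ => by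
      simp [periodic_circleMap 0 r θ]
    have h := hper.intervalIntegral_add_eq (-Real.pi) 0
    rw [zero_add, show -Real.pi + 2 * Real.pi = Real.pi by ring] at h
    simp only
    rw [← h, intervalIntegral.integral_of_le (by linarith [Real.pi_pos]),
      integral_Ioc_eq_integral_Ioo]
  · exact (hcont.continuousOn.integrableOn_compact (isCompact_Icc.prod isCompact_Icc)).mono_set
      (prod_mono Ioo_subset_Icc_self Ioo_subset_Icc_self)

lemma lap_eq_of_norm_eq_one (φ : ℂ → ℝ) (z e : ℂ) (he : ‖e‖ = 1) :
    lap φ z = fderiv ℝ (fderiv ℝ φ) z e e +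
      fderiv ℝ (fderiv ℝ φ) z (e * Complex.I) (e * Complex.I) := by
  have hsq : e.re * e.re + e.im * e.im = 1 := by
    rw [← Complex.normSq_apply, Complex.normSq_eq_norm_sq, he, one_pow]
  have h1 : e = e.re • (1 : ℂ) + e.im • Complex.I := by
    apply Complex.ext <;> simp
  have h2 : e * Complex.I = (-e.im) • (1 : ℂ) + e.re • Complex.I := by
    apply Complex.ext <;> simp
  rw [h2, lap]
  generalize fderiv ℝ (fderiv ℝ φ) z = B
  conv_rhs => enter [1]; rw [h1]
  simp only [map_add, map_smul, add_apply, smul_apply, smul_eq_mul]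
  linear_combination (-(B 1 1) - B Complex.I Complex.I) * hsq

lemma hasDerivAt_circleMap_radius (θ r : ℝ) :
    HasDerivAt (fun r => circleMap 0 r θ) (circleMap 0 1 θ) r := by
  simpa [circleMap] using
    (Complex.ofRealCLM.hasDerivAt (x := r)).mul_const (Complex.exp (θ * Complex.I))

lemma continuous_lap {φ : ℂ → ℝ} (hφ : ContDiff ℝ 2 φ) : Continuous (lap φ) := by
  have h2 : Continuous (fderiv ℝ (fderiv ℝ φ)) :=
    (hφ.fderiv_right (m := 1) (by norm_num)).continuous_fderiv (by norm_num)
  unfold lap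
  fun_prop

/-- The flux of `∇φ` through a circle, divided by its radius. -/
def radialFlux (φ : ℂ → ℝ) (r : ℝ) : ℝ :=
  ∫ θ in 0..2 * Real.pi, fderiv ℝ φ (circleMap 0 r θ) (circleMap 0 1 θ)

lemma continuous_radialFlux {φ : ℂ → ℝ} (hφ : ContDiff ℝ 1 φ) : Continuous (radialFlux φ) := by
  have h1 : Continuous (fderiv ℝ φ) := hφ.continuous_fderiv (by norm_num)
  apply intervalIntegral.continuous_parametric_intervalIntegral_of_continuous'
  simp only [Function.uncurry_def]
  fun_prop

/-- Integrating `∂²φ/∂θ²` over a full circle gives `0`; since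
`r⁻¹ ∂²φ/∂θ² = r D²φ(τ, τ) - ∂φ/∂r` with `τ` the unit tangent, the two terms agree on average. -/
lemma integral_tangential_sndDeriv {φ : ℂ → ℝ} (hφ : ContDiff ℝ 2 φ) (r : ℝ) :
    ∫ θ in 0..2 * Real.pi, r * fderiv ℝ (fderiv ℝ φ) (circleMap 0 r θ)
        (circleMap 0 1 θ * Complex.I) (circleMap 0 1 θ * Complex.I) =
      radialFlux φ r := by
  have hd : ContDiff ℝ 1 (fderiv ℝ φ) := hφ.fderiv_right (by norm_num)
  have h1 : Continuous (fderiv ℝ φ) := hd.continuous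
  have h2 : Continuous (fderiv ℝ (fderiv ℝ φ)) := hd.continuous_fderiv (by norm_num)
  have hc1 : Continuous fun θ => fderiv ℝ φ (circleMap 0 r θ) (circleMap 0 1 θ) := by fun_prop
  have hc2 : Continuous fun θ => r * fderiv ℝ (fderiv ℝ φ) (circleMap 0 r θ)
        (circleMap 0 1 θ * Complex.I) (circleMap 0 1 θ * Complex.I) := by fun_prop
  have hderiv (θ : ℝ) : HasDerivAt
      (fun θ => fderiv ℝ φ (circleMap 0 r θ) (circleMap 0 1 θ * Complex.I))
      (r * fderiv ℝ (fderiv ℝ φ) (circleMap 0 r θ)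
        (circleMap 0 1 θ * Complex.I) (circleMap 0 1 θ * Complex.I) -
        fderiv ℝ φ (circleMap 0 r θ) (circleMap 0 1 θ)) θ := by
    have hA := ((hd.differentiable (by norm_num) _).hasFDerivAt).comp_hasDerivAt θ
      (hasDerivAt_circleMap 0 r θ)
    have hB := (hasDerivAt_circleMap 0 1 θ).mul_const Complex.I
    refine (hA.clm_apply hB).congr_deriv ?_
    have hr : circleMap 0 r θ * Complex.I = r • (circleMap 0 1 θ * Complex.I) := by
      simp [circleMap, mul_assoc]
    have hI : circleMap 0 1 θ * Complex.I * Complex.I = -circleMap 0 1 θ := by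
      rw [mul_assoc, Complex.I_mul_I]; ring
    simp only [Function.comp_apply, hr, hI, map_smul, map_neg, smul_apply,
      smul_eq_mul, sub_eq_add_neg]
  have hint := intervalIntegral.integral_eq_sub_of_hasDerivAt (a := 0) (b := 2 * Real.pi)
    (fun θ _ => hderiv θ) ((hc2.sub hc1).intervalIntegrable _ _)
  rw [intervalIntegral.integral_sub (hc2.intervalIntegrable _ _)
    (hc1.intervalIntegrable _ _)] at hint
  have hp (s : ℝ) : circleMap 0 s (2 * Real.pi) = circleMap 0 s 0 := by
    simpa using periodic_circleMap 0 s 0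
  rw [hp, hp, sub_self, sub_eq_zero] at hint
  exact hint

/-- The divergence theorem for `∇φ` on a disk. -/
lemma integral_ball_lap {φ : ℂ → ℝ} (hφ : ContDiff ℝ 2 φ) {R : ℝ} (hR : 0 ≤ R) :
    ∫ z in ball (0 : ℂ) R, lap φ z = R * radialFlux φ R := by
  have hd : ContDiff ℝ 1 (fderiv ℝ φ) := hφ.fderiv_right (by norm_num)
  have h1 : Continuous (fderiv ℝ φ) := hd.continuous
  have h2 : Continuous (fderiv ℝ (fderiv ℝ φ)) := hd.continuous_fderiv (by norm_num)
  have hinner (r : ℝ) : ∫ θ in 0..2 * Real.pi, r * lap φ (circleMap 0 r θ) =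
      ∫ θ in 0..2 * Real.pi, (fderiv ℝ φ (circleMap 0 r θ) (circleMap 0 1 θ) +
        r * fderiv ℝ (fderiv ℝ φ) (circleMap 0 r θ) (circleMap 0 1 θ) (circleMap 0 1 θ)) := by
    have hc (v : ℂ) : Continuous fun θ => r * fderiv ℝ (fderiv ℝ φ) (circleMap 0 r θ)
        (circleMap 0 1 θ * v) (circleMap 0 1 θ * v) := by fun_prop
    have hc0 := hc 1
    simp only [mul_one] at hc0
    have hc1 : Continuous fun θ => fderiv ℝ φ (circleMap 0 r θ) (circleMap 0 1 θ) := by fun_prop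
    simp_rw [fun θ => lap_eq_of_norm_eq_one φ (circleMap 0 r θ) (circleMap 0 1 θ) (by simp),
      mul_add]
    rw [intervalIntegral.integral_add (hc0.intervalIntegrable _ _)
        ((hc Complex.I).intervalIntegrable _ _), integral_tangential_sndDeriv hφ,
      intervalIntegral.integral_add (hc1.intervalIntegrable _ _) (hc0.intervalIntegrable _ _),
      add_comm, radialFlux]
  have hcont : Continuous fun p : ℝ × ℝ => fderiv ℝ φ (circleMap 0 p.1 p.2) (circleMap 0 1 p.2) +
      p.1 * fderiv ℝ (fderiv ℝ φ) (circleMap 0 p.1 p.2) (circleMap 0 1 p.2)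
        (circleMap 0 1 p.2) := by
    fun_prop
  rw [integral_ball_eq_integral_circleMap (continuous_lap hφ) hR]
  simp_rw [hinner]
  rw [intervalIntegral_intervalIntegral_swap, radialFlux, ← intervalIntegral.integral_const_mul]
  · refine intervalIntegral.integral_congr fun θ _ => ?_
    have hderiv (r : ℝ) : HasDerivAt
        (fun r => r * fderiv ℝ φ (circleMap 0 r θ) (circleMap 0 1 θ))
        (fderiv ℝ φ (circleMap 0 r θ) (circleMap 0 1 θ) +
          r * fderiv ℝ (fderiv ℝ φ) (circleMap 0 r θ) (circleMap 0 1 θ) (circleMap 0 1 θ)) r := by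
      have hA := ((hd.differentiable (by norm_num) _).hasFDerivAt).comp_hasDerivAt r
        (hasDerivAt_circleMap_radius θ r)
      refine ((hasDerivAt_id r).mul
        (hA.clm_apply (hasDerivAt_const r (circleMap 0 1 θ)))).congr_deriv ?_
      simp
    have hc : Continuous fun r => fderiv ℝ φ (circleMap 0 r θ) (circleMap 0 1 θ) +
        r * fderiv ℝ (fderiv ℝ φ) (circleMap 0 r θ) (circleMap 0 1 θ) (circleMap 0 1 θ) := by
      fun_prop
    simpa using intervalIntegral.integral_eq_sub_of_hasDerivAt (a := 0) (b := R)
      (fun r _ => hderiv r) (hc.intervalIntegrable _ _)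
  · exact (hcont.continuousOn.integrableOn_compact (isCompact_uIcc.prod isCompact_uIcc)).mono_set
      (prod_mono uIoc_subset_uIcc uIoc_subset_uIcc)

lemma integral_radialFlux {φ : ℂ → ℝ} (hφ : ContDiff ℝ 1 φ) (R₀ R : ℝ) :
    ∫ r in R₀..R, radialFlux φ r =
      2 * Real.pi * (Real.circleAverage φ 0 R - Real.circleAverage φ 0 R₀) := by
  have h1 : Continuous (fderiv ℝ φ) := hφ.continuous_fderiv (by norm_num)
  have hcφ := hφ.continuous
  have hcont : Continuous fun p : ℝ × ℝ =>
      fderiv ℝ φ (circleMap 0 p.1 p.2) (circleMap 0 1 p.2) := by fun_prop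
  have hc (s : ℝ) : Continuous fun θ => φ (circleMap 0 s θ) := by fun_prop
  unfold radialFlux
  rw [intervalIntegral_intervalIntegral_swap, Real.circleAverage_def, Real.circleAverage_def,
    ← smul_sub, ← intervalIntegral.integral_sub ((hc R).intervalIntegrable _ _)
      ((hc R₀).intervalIntegrable _ _), smul_eq_mul, mul_inv_cancel_left₀ (by positivity)]
  · refine intervalIntegral.integral_congr fun θ _ => ?_
    have hc' : Continuous fun r => fderiv ℝ φ (circleMap 0 r θ) (circleMap 0 1 θ) := by fun_prop
    exact intervalIntegral.integral_eq_sub_of_hasDerivAt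
      (fun r _ => ((hφ.differentiable (by norm_num) _).hasFDerivAt).comp_hasDerivAt r
        (hasDerivAt_circleMap_radius θ r)) (hc'.intervalIntegrable _ _)
  · exact (hcont.continuousOn.integrableOn_compact (isCompact_uIcc.prod isCompact_uIcc)).mono_set
      (prod_mono uIoc_subset_uIcc uIoc_subset_uIcc)

lemma analyticOrderAt_eq_ordAt {f : ℂ → ℂ} (hf : Differentiable ℂ f) {w : ℂ} (hw : f w ≠ 0)
    (z : ℂ) :
    analyticOrderAt f z = ordAt f z := by
  have han : AnalyticOnNhd ℂ f univ := fun z _ => hf.analyticAt z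
  have htop : analyticOrderAt f z ≠ ⊤ :=
    han.analyticOrderAt_ne_top_of_isPreconnected (x := w) isPreconnected_univ trivial trivial
      (by simp [(hf.analyticAt w).analyticOrderAt_eq_zero.mpr hw])
  obtain ⟨n, hn⟩ := ENat.ne_top_iff_exists.mp htop
  obtain ⟨hlt, hne⟩ :=
    (analyticOrderAt_eq_nat_iff_iteratedDeriv_eq_zero (hf.analyticAt z)).mp hn.symm
  rw [← hn, Nat.cast_inj]
  refine le_antisymm (le_csInf ⟨n, hne⟩ fun k hk => ?_) (Nat.sInf_le hne)
  by_contra! hkn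
  exact hk (hlt k hkn)

lemma divisor_closedBall_eq_ordAt {f : ℂ → ℂ} (hf : Differentiable ℂ f) {w : ℂ} (hw : f w ≠ 0)
    {R : ℝ} {z : ℂ} (hz : z ∈ closedBall (0 : ℂ) R) :
    MeromorphicOn.divisor f (closedBall 0 R) z = ordAt f z := by
  have han : AnalyticOnNhd ℂ f (closedBall 0 R) := fun z _ => hf.analyticAt z
  rw [MeromorphicOn.AnalyticOnNhd.divisor_apply han hz, analyticOrderAt_eq_ordAt hf hw]
  simp

lemma finite_inter_support_ordAt {f : ℂ → ℂ} (hf : Differentiable ℂ f) {w : ℂ} (hw : f w ≠ 0)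
    (R : ℝ) : (closedBall (0 : ℂ) R ∩ Function.support (ordAt f)).Finite := by
  refine ((MeromorphicOn.divisor f (closedBall 0 R)).finiteSupport
    (isCompact_closedBall 0 R)).subset fun z hz => ?_
  rw [Function.mem_support, divisor_closedBall_eq_ordAt hf hw hz.1]
  exact_mod_cast hz.2

lemma nZeros_eq_sum {f : ℂ → ℂ} {R t : ℝ} {s : Finset ℂ}
    (hs : (s : Set ℂ) = closedBall (0 : ℂ) R ∩ Function.support (ordAt f)) (ht : t ≤ R) :
    (nZeros f t : ℝ) = ∑ z ∈ s, if ‖z‖ ≤ t then (ordAt f z : ℝ) else 0 := by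
  rw [nZeros, finsum_mem_def, finsum_eq_sum_of_support_subset (s := s)]
  · push_cast
    refine Finset.sum_congr rfl fun z _ => ?_
    by_cases h : ‖z‖ ≤ t <;> simp [indicator, h]
  · rw [support_indicator, hs]
    exact inter_subset_inter_left _ (closedBall_subset_closedBall ht)

lemma intervalIntegrable_ite_inv {a b : ℝ} (ha : 0 < a) (hab : a ≤ b) (ρ : ℝ) :
    IntervalIntegrable (fun t => if ρ ≤ t then t⁻¹ else 0) volume a b := by
  have h : IntervalIntegrable (fun t : ℝ => t⁻¹) volume a b :=
    intervalIntegral.intervalIntegrable_inv (fun t ht => by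
      rw [uIcc_of_le hab] at ht; exact (ha.trans_le ht.1).ne') continuousOn_id
  rw [intervalIntegrable_iff] at h ⊢
  exact h.indicator (measurableSet_Ici (a := ρ))

lemma integral_ite_inv_le_log {a b ρ : ℝ} (ha : 0 < a) (hab : a ≤ b) (hρ : 0 < ρ) (hρb : ρ ≤ b) :
    ∫ t in a..b, (if ρ ≤ t then t⁻¹ else 0) ≤ Real.log (b * ρ⁻¹) := by
  have hb : 0 < b := ha.trans_le hab
  have hint : IntegrableOn (fun t : ℝ => t⁻¹) (Icc ρ b) :=
    (continuousOn_id.inv₀ fun t ht => (hρ.trans_le ht.1).ne').integrableOn_Icc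
  calc ∫ t in a..b, (if ρ ≤ t then t⁻¹ else 0)
      = ∫ t in Ioc a b ∩ Ici ρ, t⁻¹ := by
        rw [intervalIntegral.integral_of_le hab, ← setIntegral_indicator measurableSet_Ici]
        rfl
    _ ≤ ∫ t in Icc ρ b, t⁻¹ := by
        refine setIntegral_mono_set hint ?_ (Eventually.of_forall fun t ht => ⟨ht.2, ht.1.2⟩)
        exact (ae_restrict_mem measurableSet_Icc).mono fun t ht =>
          inv_nonneg.mpr (hρ.le.trans ht.1)
    _ = Real.log (b * ρ⁻¹) := by
        rw [integral_Icc_eq_integral_Ioc, ← intervalIntegral.integral_of_le hρb,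
          integral_inv_of_pos hρ hb, div_eq_mul_inv]

lemma intervalIntegrable_nZeros_div {f : ℂ → ℂ} (hf : Differentiable ℂ f) {w : ℂ} (hw : f w ≠ 0)
    {a b : ℝ} (ha : 0 < a) (hab : a ≤ b) :
    IntervalIntegrable (fun t => (nZeros f t : ℝ) * t⁻¹) volume a b := by
  have hs := (finite_inter_support_ordAt hf hw b).coe_toFinset
  refine (IntervalIntegrable.sum (finite_inter_support_ordAt hf hw b).toFinset (fun z _ =>
    (intervalIntegrable_ite_inv ha hab ‖z‖).const_mul (ordAt f z : ℝ))).congr ?_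
  intro t ht
  rw [uIoc_of_le hab] at ht
  simp only [Finset.sum_apply, nZeros_eq_sum hs ht.2, Finset.sum_mul]
  refine Finset.sum_congr rfl fun z _ => ?_
  split_ifs <;> simp

/-- One half of Jensen's formula, written with the zero counting function. -/
lemma integral_nZeros_div_le {f : ℂ → ℂ} (hf : Differentiable ℂ f) (hf0 : f 0 ≠ 0)
    {a b : ℝ} (ha : 0 < a) (hab : a ≤ b) :
    ∫ t in a..b, (nZeros f t : ℝ) * t⁻¹ ≤
      Real.circleAverage (fun z => Real.log ‖f z‖) 0 b - Real.log ‖f 0‖ := by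
  have hb : 0 < b := ha.trans_le hab
  have hfin := finite_inter_support_ordAt hf hf0 b
  have hs := hfin.coe_toFinset
  have han : AnalyticOnNhd ℂ f (closedBall 0 |b|) := fun z _ => hf.analyticAt z
  have hJ := han.circleAverage_log_norm hb.ne' hf0
  rw [hJ, add_sub_cancel_right, abs_of_pos hb, finsum_eq_sum_of_support_subset (s := hfin.toFinset)]
  · have hcongr : ∫ t in a..b, (nZeros f t : ℝ) * t⁻¹ =
        ∫ t in a..b, ∑ z ∈ hfin.toFinset, (ordAt f z : ℝ) * (if ‖z‖ ≤ t then t⁻¹ else 0) := by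
      refine intervalIntegral.integral_congr fun t ht => ?_
      rw [uIcc_of_le hab] at ht
      simp only [nZeros_eq_sum hs ht.2, Finset.sum_mul]
      refine Finset.sum_congr rfl fun z _ => ?_
      split_ifs <;> simp
    rw [hcongr, intervalIntegral.integral_finsetSum
      fun z _ => (intervalIntegrable_ite_inv ha hab ‖z‖).const_mul _]
    refine Finset.sum_le_sum fun z hz => ?_
    obtain ⟨hzb, hz0⟩ := hfin.mem_toFinset.mp hz
    have hz_ne : z ≠ 0 := by
      rintro rfl
      have h := analyticOrderAt_eq_ordAt hf hf0 0
      rw [(hf.analyticAt 0).analyticOrderAt_eq_zero.mpr hf0] at h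
      exact hz0 (by exact_mod_cast h.symm)
    rw [divisor_closedBall_eq_ordAt hf hf0 hzb, intervalIntegral.integral_const_mul, zero_sub,
      norm_neg]
    push_cast
    gcongr
    exact integral_ite_inv_le_log ha hab (norm_pos_iff.mpr hz_ne) (by simpa using hzb)
  · intro z hz
    rw [hs]
    have hd : MeromorphicOn.divisor f (closedBall 0 b) z ≠ 0 := fun h => hz (by simp [h])
    have hzb : z ∈ closedBall (0 : ℂ) b := by
      by_contra h
      exact hd ((MeromorphicOn.divisor f (closedBall 0 b)).apply_eq_zero_of_notMem h)
    rw [divisor_closedBall_eq_ordAt hf hf0 hzb] at hd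
    exact ⟨hzb, by exact_mod_cast hd⟩

lemma circleAverage_log_norm_le {f : ℂ → ℂ} (hf : Differentiable ℂ f) {w : ℂ} (hw : f w ≠ 0)
    {u : ℂ → ℝ} (hu : Continuous u) (h : ∀ z, ‖f z‖ ≤ Real.exp (u z)) {R : ℝ} (hR : R ≠ 0) :
    Real.circleAverage (fun z => Real.log ‖f z‖) 0 R ≤ Real.circleAverage u 0 R := by
  classical
  have han : AnalyticOnNhd ℂ f univ := fun z _ => hf.analyticAt z
  set g : ℂ → ℝ := fun z => if f z = 0 then u z else Real.log ‖f z‖ with hg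
  have heq : (fun z => Real.log ‖f z‖) =ᶠ[codiscreteWithin (sphere 0 |R|)] g := by
    refine codiscreteWithin_mono (subset_univ _) ?_
    filter_upwards [han.preimage_zero_mem_codiscrete hw] with z hz
    exact (if_neg hz).symm
  have hint : CircleIntegrable (fun z => Real.log ‖f z‖) 0 R :=
    MeromorphicOn.circleIntegrable_log_norm fun z _ => (hf.analyticAt z).meromorphicAt
  rw [Real.circleAverage_congr_codiscreteWithin heq hR]
  refine Real.circleAverage_mono (hint.congr_codiscreteWithin heq)
    hu.continuousOn.circleIntegrable' fun z _ => ?_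
  simp only [hg]
  split_ifs with hz
  · exact le_rfl
  · exact (Real.log_le_iff_le_exp (norm_pos_iff.mpr hz)).mpr (h z)

lemma mul_le_radialFlux {φ : ℂ → ℝ} (hφ : ContDiff ℝ 2 φ) {c : ℝ} (hl : ∀ z, c ≤ lap φ z)
    {r : ℝ} (hr : 0 < r) : c * Real.pi * r ≤ radialFlux φ r := by
  have hint : IntegrableOn (lap φ) (ball 0 r) :=
    ((continuous_lap hφ).continuousOn.integrableOn_compact (isCompact_closedBall 0 r)).mono_set
      ball_subset_closedBall
  have h : ∫ _ in ball (0 : ℂ) r, c ≤ ∫ z in ball (0 : ℂ) r, lap φ z :=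
    setIntegral_mono (integrableOn_const measure_ball_lt_top.ne) hint hl
  rw [setIntegral_const, integral_ball_lap hφ hr.le, measureReal_def, Complex.volume_ball,
    smul_eq_mul] at h
  simp only [ENNReal.toReal_mul, ENNReal.toReal_pow, ENNReal.toReal_ofReal hr.le,
    ENNReal.coe_toReal, NNReal.coe_real_pi] at h
  refine le_of_mul_le_mul_left ?_ hr
  linarith

/-- **Zero-density bound for functions of finite weighted sup-norm.**  If `c ≤ Δφ ≤ C`
with `0 < c ≤ C`, `f` is entire, `f(0) ≠ 0` and `sup |f|e^{-φ} < ∞`, then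
`liminf_{R→∞} n(0,R) / ∫_{D(0,R)} Δφ dA ≤ 1/(2π)`: the zero set of such a function
cannot have lower density exceeding the critical one. -/
theorem zero_density_bound
    (φ : ℂ → ℝ) (hφ : ContDiff ℝ 2 φ) (c C : ℝ) (hc : 0 < c) (hcC : c ≤ C)
    (hl : ∀ z : ℂ, c ≤ lap φ z) (hu : ∀ z : ℂ, lap φ z ≤ C)
    (f : ℂ → ℂ) (hf : Differentiable ℂ f) (hf0 : f 0 ≠ 0)
    (hbd : BddAbove (Set.range fun z : ℂ => ‖f z‖ * Real.exp (-φ z))) :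
    Filter.liminf
        (fun R : ℝ => (nZeros f R : ℝ) / ∫ z in Metric.ball (0 : ℂ) R, lap φ z)
        Filter.atTop ≤ 1 / (2 * Real.pi) := by
  have hI (r : ℝ) (hr : 0 < r) := integral_ball_lap hφ hr.le
  have hF (r : ℝ) (hr : 0 < r) := mul_le_radialFlux hφ hl hr
  have hFpos (r : ℝ) (hr : 0 < r) : 0 < radialFlux φ r :=
    lt_of_lt_of_le (by positivity) (hF r hr)
  rw [Filter.liminf_eq]
  refine csSup_le ⟨0, ?_⟩ fun a ha => ?_
  · filter_upwards [eventually_gt_atTop 0] with R hR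
    rw [hI R hR]
    have := hFpos R hR
    positivity
  by_contra! hlt
  obtain ⟨R₀, hR₀⟩ := eventually_atTop.mp (ha.and (eventually_ge_atTop (1 : ℝ)))
  have hR₀pos : 0 < R₀ := by linarith [(hR₀ R₀ le_rfl).2]
  obtain ⟨M, hM⟩ := hbd
  have hfM (z : ℂ) : ‖f z‖ ≤ Real.exp (M + φ z) := by
    have h1 : ‖f z‖ * Real.exp (-φ z) ≤ Real.exp M :=
      (hM ⟨z, rfl⟩).trans (by linarith [Real.add_one_le_exp M])
    rw [Real.exp_neg, ← div_eq_mul_inv, div_le_iff₀ (Real.exp_pos _)] at h1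
    rwa [Real.exp_add]
  set K := M + Real.circleAverage φ 0 R₀ - Real.log ‖f 0‖ with hK
  have hFcont : Continuous (radialFlux φ) := continuous_radialFlux (hφ.of_le (by norm_num))
  have key (R : ℝ) (hR : R₀ ≤ R) :
      (a - 1 / (2 * Real.pi)) * (c * Real.pi * R₀ * (R - R₀)) ≤ K := by
    have hRpos : 0 < R := hR₀pos.trans_le hR
    have hlow : a * ∫ r in R₀..R, radialFlux φ r ≤ ∫ t in R₀..R, (nZeros f t : ℝ) * t⁻¹ := by
      rw [← intervalIntegral.integral_const_mul]
      refine intervalIntegral.integral_mono_on hR ((hFcont.const_mul a).intervalIntegrable _ _)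
        (intervalIntegrable_nZeros_div hf hf0 hR₀pos hR) fun t ht => ?_
      have htpos : 0 < t := hR₀pos.trans_le ht.1
      have h := (hR₀ t ht.1).1
      rw [hI t htpos, le_div_iff₀ (mul_pos htpos (hFpos t htpos))] at h
      rw [← div_eq_mul_inv, le_div_iff₀ htpos]
      linarith
    have hjensen := integral_nZeros_div_le hf hf0 hR₀pos hR
    have hupper := circleAverage_log_norm_le hf hf0 (continuous_const.add hφ.continuous) hfM
      hRpos.ne'
    rw [Real.circleAverage_add continuousOn_const.circleIntegrable'
      hφ.continuous.continuousOn.circleIntegrable', Real.circleAverage_const] at hupper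
    have hgreen := integral_radialFlux (hφ.of_le (by norm_num) : ContDiff ℝ 1 φ) R₀ R
    have hgreen' : Real.circleAverage φ 0 R = Real.circleAverage φ 0 R₀ +
        1 / (2 * Real.pi) * ∫ r in R₀..R, radialFlux φ r := by
      rw [hgreen]
      field_simp
      ring
    have hgrow : c * Real.pi * R₀ * (R - R₀) ≤ ∫ r in R₀..R, radialFlux φ r := by
      have h : ∫ _ in R₀..R, c * Real.pi * R₀ ≤ ∫ r in R₀..R, radialFlux φ r := by
        refine intervalIntegral.integral_mono_on hR (by simp)
          (hFcont.intervalIntegrable _ _) fun t ht => ?_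
        refine le_trans ?_ (hF t (hR₀pos.trans_le ht.1))
        gcongr
        exact ht.1
      rw [intervalIntegral.integral_const, smul_eq_mul] at h
      linarith
    calc _ ≤ (a - 1 / (2 * Real.pi)) * ∫ r in R₀..R, radialFlux φ r :=
          mul_le_mul_of_nonneg_left hgrow (sub_nonneg.mpr hlt.le)
      _ ≤ K := by linarith
  set D := (a - 1 / (2 * Real.pi)) * (c * Real.pi * R₀) with hD
  have hDpos : 0 < D := mul_pos (sub_pos.mpr hlt) (by positivity)
  have h := key (R₀ + (|K| + 1) / D) (le_add_of_nonneg_right (by positivity))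
  rw [add_sub_cancel_left, ← mul_assoc, ← hD, mul_div_cancel₀ _ hDpos.ne'] at h
  linarith [le_abs_self K]
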